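/- Let T be a spanning tree of a balanced bipartite graph G = (V+, V-; E) such that some vertex r ∈ V+ has degree 1 in T and every other vertex of V+ has degree 2 in T. Then for any vertex set X ⊆ V+, the neighborhood of X in T has size at least |X|. -/

import Mathlib

open Sum

/-- The simple graph on `α ⊕ β` determined by an edge set `T ⊆ α × β`. -/
def sg {α β : Type*} (T : Set (α × β)) : SimpleGraph (α ⊕ β) :=
  SimpleGraph.fromRel (fun u v => ∃ a b, u = inl a ∧ v = inr b ∧ (a, b) ∈ T)

/-- Degree of `a ∈ V⁺` in the edge set `T`. -/
noncomputable def degP {α β : Type*} (T : Set (α × β)) (a : α) : ℕ :=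
  {b : β | (a, b) ∈ T}.ncard

theorem parent_exists {V : Type*} {G : SimpleGraph V} (hG : G.IsTree) (r : V) :
    ∃ p : V → V, p r = r ∧ ∀ v w, G.Adj v w → p v = w ∨ p w = v := by
  choose f hf hf' using hG.existsUnique_path r
  refine ⟨fun v => (f v).penultimate, ?_, ?_⟩
  · show (f r).penultimate = r
    rw [← hf' r SimpleGraph.Walk.nil SimpleGraph.Walk.IsPath.nil]
    simp
  · intro v w h
    show (f v).penultimate = w ∨ (f w).penultimate = v
    by_cases hw : w ∈ (f v).support
    · left
      rw [hG.isAcyclic.path_concat (hf w) (hf v) h.symm hw]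
      simp
    · right
      have hv := hG.isAcyclic.mem_support_of_ne_mem_support_of_adj_of_isPath (hf w) (hf v)
        h.symm hw
      rw [hG.isAcyclic.path_concat (hf v) (hf w) h hv]
      simp

theorem stmt7 {α β : Type*} [Fintype α] [Fintype β]
    (hbal : Fintype.card α = Fintype.card β)
    (E T : Set (α × β)) (hTE : T ⊆ E) (htree : (sg T).IsTree)
    (r : α) (hr : degP T r = 1) (hdeg : ∀ a : α, a ≠ r → degP T a = 2) :
    ∀ X : Set α, X.ncard ≤ {b : β | ∃ a ∈ X, (a, b) ∈ T}.ncard := by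
  classical
  obtain ⟨p, hpr, hp⟩ := parent_exists htree (inl r)
  have key : ∀ a : α, ∃ b : β, (a, b) ∈ T ∧ p (inr b) = inl a := by
    intro a
    have h1 : ∃ b : β, (a, b) ∈ T ∧ p (inl a) ≠ inr b := by
      by_cases ha : a = r
      · subst ha
        obtain ⟨b, hb⟩ := Set.ncard_eq_one.mp hr
        have hb' : b ∈ {b : β | (a, b) ∈ T} := by rw [hb]; rfl
        exact ⟨b, hb', by rw [hpr]; simp⟩
      · obtain ⟨b, c, hbc, hb⟩ := Set.ncard_eq_two.mp (hdeg a ha)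
        have hb' : b ∈ {b : β | (a, b) ∈ T} := by rw [hb]; simp
        have hc' : c ∈ {b : β | (a, b) ∈ T} := by rw [hb]; simp
        by_cases h : p (inl a) = inr b
        · exact ⟨c, hc', by rw [h]; simpa using hbc⟩
        · exact ⟨b, hb', h⟩
    obtain ⟨b, hb, hne⟩ := h1
    have hadj : (sg T).Adj (inl a) (inr b) := by
      unfold sg
      rw [SimpleGraph.fromRel_adj]
      exact ⟨by simp, Or.inl ⟨a, b, rfl, rfl, hb⟩⟩
    exact ⟨b, hb, (hp _ _ hadj).resolve_left hne⟩
  choose g hgT hgp using key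
  intro X
  refine Set.ncard_le_ncard_of_injOn g (fun a ha => ⟨a, ha, hgT a⟩) ?_ (Set.toFinite _)
  intro a _ a' _ h
  have h2 := hgp a
  rw [h, hgp a'] at h2
  exact (Sum.inl.inj h2).symm
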